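/- Let u : ℝ³ → ℝ be a smooth solution of the modified Veronese web equation u_ty = u_t u_xy − u_y u_tx, let λ ∈ ℝ with λ ≠ 0 and λ ≠ −1, and let s : ℝ³ → ℝ be a smooth function satisfying the first-order system s_t = (λ+1)⁻¹ ( u_t s_x − u_tx s ) and s_y = λ⁻¹ ( u_y s_x − u_xy s ) at every point. Then s satisfies the linearized modified Veronese web equation ℓ_E(s) := s_ty − u_t s_xy + u_y s_tx − u_xy s_t + u_tx s_y = 0 at every point of ℝ³. In particular, if q is a smooth solution of the Lax pair q_t = (λ+1)⁻¹ u_t q_x, q_y = λ⁻¹ u_y q_x with q_x nowhere vanishing, then s := 1/q_x satisfies this system and hence ℓ_E(1/q_x) = 0. -/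

import Mathlib

noncomputable section

/-- Partial derivative with respect to the first variable (`x`). -/
def Dx (f : ℝ → ℝ → ℝ → ℝ) (x y t : ℝ) : ℝ := deriv (fun x' => f x' y t) x

/-- Partial derivative with respect to the second variable (`y`). -/
def Dy (f : ℝ → ℝ → ℝ → ℝ) (x y t : ℝ) : ℝ := deriv (fun y' => f x y' t) y

/-- Partial derivative with respect to the third variable (`t`). -/
def Dt (f : ℝ → ℝ → ℝ → ℝ) (x y t : ℝ) : ℝ := deriv (fun t' => f x y t') t

/-- Smoothness of a function of three real variables `(x, y, t)`. -/
def Smooth3 (f : ℝ → ℝ → ℝ → ℝ) : Prop :=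
  ContDiff ℝ (⊤ : ℕ∞) (fun p : ℝ × ℝ × ℝ => f p.1 p.2.1 p.2.2)

/-- Linearization of the modified Veronese web equation `u_ty = u_t u_xy - u_y u_tx`
at a solution `u`. -/
def linMVWE (u φ : ℝ → ℝ → ℝ → ℝ) (x y t : ℝ) : ℝ :=
  Dt (Dy φ) x y t - Dt u x y t * Dx (Dy φ) x y t + Dy u x y t * Dt (Dx φ) x y t
    - Dx (Dy u) x y t * Dt φ x y t + Dt (Dx u) x y t * Dy φ x y t

namespace Smooth3

/-- The uncurried form of a function of three real variables. -/
def uncurry3 (f : ℝ → ℝ → ℝ → ℝ) (p : ℝ × ℝ × ℝ) : ℝ := f p.1 p.2.1 p.2.2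

variable {f : ℝ → ℝ → ℝ → ℝ}

theorem differentiableAt (hf : Smooth3 f) (p : ℝ × ℝ × ℝ) :
    DifferentiableAt ℝ (uncurry3 f) p :=
  (ContDiff.differentiable hf (by simp)) p

theorem hasDerivAt_fst (hf : Smooth3 f) (x y t : ℝ) :
    HasDerivAt (fun x' => f x' y t) (fderiv ℝ (uncurry3 f) (x, y, t) (1, 0, 0)) x :=
  HasFDerivAt.comp_hasDerivAt (l := uncurry3 f) x (hf.differentiableAt (x, y, t)).hasFDerivAt
    ((hasDerivAt_id x).prodMk ((hasDerivAt_const x y).prodMk (hasDerivAt_const x t)))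

theorem hasDerivAt_snd (hf : Smooth3 f) (x y t : ℝ) :
    HasDerivAt (fun y' => f x y' t) (fderiv ℝ (uncurry3 f) (x, y, t) (0, 1, 0)) y :=
  HasFDerivAt.comp_hasDerivAt (l := uncurry3 f) y (hf.differentiableAt (x, y, t)).hasFDerivAt
    ((hasDerivAt_const y x).prodMk ((hasDerivAt_id y).prodMk (hasDerivAt_const y t)))

theorem hasDerivAt_trd (hf : Smooth3 f) (x y t : ℝ) :
    HasDerivAt (fun t' => f x y t') (fderiv ℝ (uncurry3 f) (x, y, t) (0, 0, 1)) t :=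
  HasFDerivAt.comp_hasDerivAt (l := uncurry3 f) t (hf.differentiableAt (x, y, t)).hasFDerivAt
    ((hasDerivAt_const t x).prodMk ((hasDerivAt_const t y).prodMk (hasDerivAt_id t)))

theorem uncurry3_Dx (hf : Smooth3 f) :
    uncurry3 (Dx f) = fun p => fderiv ℝ (uncurry3 f) p (1, 0, 0) :=
  funext fun p => (hf.hasDerivAt_fst p.1 p.2.1 p.2.2).deriv

theorem uncurry3_Dy (hf : Smooth3 f) :
    uncurry3 (Dy f) = fun p => fderiv ℝ (uncurry3 f) p (0, 1, 0) :=
  funext fun p => (hf.hasDerivAt_snd p.1 p.2.1 p.2.2).deriv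

theorem uncurry3_Dt (hf : Smooth3 f) :
    uncurry3 (Dt f) = fun p => fderiv ℝ (uncurry3 f) p (0, 0, 1) :=
  funext fun p => (hf.hasDerivAt_trd p.1 p.2.1 p.2.2).deriv

theorem contDiff_fderiv_apply (hf : Smooth3 f) (v : ℝ × ℝ × ℝ) :
    ContDiff ℝ (⊤ : ℕ∞) fun p => fderiv ℝ (uncurry3 f) p v :=
  (ContDiff.fderiv_right (m := ((⊤ : ℕ∞) : WithTop ℕ∞)) hf (by simp)).clm_apply contDiff_const

theorem smooth3_Dx (hf : Smooth3 f) : Smooth3 (Dx f) := by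
  change ContDiff ℝ _ (uncurry3 (Dx f))
  exact hf.uncurry3_Dx ▸ hf.contDiff_fderiv_apply _

theorem smooth3_Dy (hf : Smooth3 f) : Smooth3 (Dy f) := by
  change ContDiff ℝ _ (uncurry3 (Dy f))
  exact hf.uncurry3_Dy ▸ hf.contDiff_fderiv_apply _

theorem smooth3_Dt (hf : Smooth3 f) : Smooth3 (Dt f) := by
  change ContDiff ℝ _ (uncurry3 (Dt f))
  exact hf.uncurry3_Dt ▸ hf.contDiff_fderiv_apply _

theorem one_div (hf : Smooth3 f) (h0 : ∀ x y t, f x y t ≠ 0) :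
    Smooth3 fun x y t => 1 / f x y t :=
  contDiff_const.div hf fun p => h0 p.1 p.2.1 p.2.2

theorem hasDerivAt_Dx (hf : Smooth3 f) (x y t : ℝ) :
    HasDerivAt (fun x' => f x' y t) (Dx f x y t) x :=
  (hf.hasDerivAt_fst x y t).differentiableAt.hasDerivAt

theorem hasDerivAt_Dy (hf : Smooth3 f) (x y t : ℝ) :
    HasDerivAt (fun y' => f x y' t) (Dy f x y t) y :=
  (hf.hasDerivAt_snd x y t).differentiableAt.hasDerivAt

theorem hasDerivAt_Dt (hf : Smooth3 f) (x y t : ℝ) :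
    HasDerivAt (fun t' => f x y t') (Dt f x y t) t :=
  (hf.hasDerivAt_trd x y t).differentiableAt.hasDerivAt

theorem fderiv_fderiv_apply_comm (hf : Smooth3 f) (p v w : ℝ × ℝ × ℝ) :
    fderiv ℝ (fun p' => fderiv ℝ (uncurry3 f) p' v) p w =
      fderiv ℝ (fun p' => fderiv ℝ (uncurry3 f) p' w) p v := by
  have hd : DifferentiableAt ℝ (fderiv ℝ (uncurry3 f)) p :=
    (ContDiff.fderiv_right (m := 1) hf (by norm_cast)).differentiable (by simp) p
  rw [fderiv_clm_apply hd (differentiableAt_const v),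
    fderiv_clm_apply hd (differentiableAt_const w)]
  have hsymm : IsSymmSndFDerivAt ℝ (uncurry3 f) p :=
    (ContDiff.contDiffAt hf).isSymmSndFDerivAt (by
      rw [minSmoothness_of_isRCLikeNormedField]; norm_cast)
  simpa using hsymm.eq w v

theorem Dx_Dy_comm (hf : Smooth3 f) : Dx (Dy f) = Dy (Dx f) := by
  funext x y t
  refine (hf.smooth3_Dy.hasDerivAt_fst x y t).deriv.trans
    (Eq.trans ?_ (hf.smooth3_Dx.hasDerivAt_snd x y t).deriv.symm)
  rw [hf.uncurry3_Dx, hf.uncurry3_Dy, hf.fderiv_fderiv_apply_comm]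

theorem Dx_Dt_comm (hf : Smooth3 f) : Dx (Dt f) = Dt (Dx f) := by
  funext x y t
  refine (hf.smooth3_Dt.hasDerivAt_fst x y t).deriv.trans
    (Eq.trans ?_ (hf.smooth3_Dx.hasDerivAt_trd x y t).deriv.symm)
  rw [hf.uncurry3_Dx, hf.uncurry3_Dt, hf.fderiv_fderiv_apply_comm]

theorem Dy_Dt_comm (hf : Smooth3 f) : Dy (Dt f) = Dt (Dy f) := by
  funext x y t
  refine (hf.smooth3_Dt.hasDerivAt_snd x y t).deriv.trans
    (Eq.trans ?_ (hf.smooth3_Dy.hasDerivAt_trd x y t).deriv.symm)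
  rw [hf.uncurry3_Dy, hf.uncurry3_Dt, hf.fderiv_fderiv_apply_comm]

end Smooth3

/-- The two expressions for `s_ty` obtained from the covering differ by `ℓ_E(s)`, because
`(λ + 1) - λ = 1`; that `u` solves the equation is only needed for compatibility. -/
theorem linMVWE_eq_zero_of_covering {u s : ℝ → ℝ → ℝ → ℝ} {lam : ℝ}
    (hu : Smooth3 u) (hlam0 : lam ≠ 0) (hlam1 : lam ≠ -1) (hs : Smooth3 s)
    (hst : ∀ x y t : ℝ,
      Dt s x y t = (lam + 1)⁻¹ * (Dt u x y t * Dx s x y t - Dt (Dx u) x y t * s x y t))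
    (hsy : ∀ x y t : ℝ,
      Dy s x y t = lam⁻¹ * (Dy u x y t * Dx s x y t - Dx (Dy u) x y t * s x y t))
    (x y t : ℝ) : linMVWE u s x y t = 0 := by
  have hl1 : lam + 1 ≠ 0 := fun h => hlam1 (by linarith)
  have hty : Dt (Dy s) x y t = lam⁻¹ *
      (Dt (Dy u) x y t * Dx s x y t + Dy u x y t * Dt (Dx s) x y t
        - (Dt (Dx (Dy u)) x y t * s x y t + Dx (Dy u) x y t * Dt s x y t)) := by
    refine HasDerivAt.deriv ?_
    simp only [hsy]
    exact (((hu.smooth3_Dy.hasDerivAt_Dt x y t).mul (hs.smooth3_Dx.hasDerivAt_Dt x y t)).sub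
      ((hu.smooth3_Dy.smooth3_Dx.hasDerivAt_Dt x y t).mul (hs.hasDerivAt_Dt x y t))).const_mul _
  have hyt : Dy (Dt s) x y t = (lam + 1)⁻¹ *
      (Dy (Dt u) x y t * Dx s x y t + Dt u x y t * Dy (Dx s) x y t
        - (Dy (Dt (Dx u)) x y t * s x y t + Dt (Dx u) x y t * Dy s x y t)) := by
    refine HasDerivAt.deriv ?_
    simp only [hst]
    exact (((hu.smooth3_Dt.hasDerivAt_Dy x y t).mul (hs.smooth3_Dx.hasDerivAt_Dy x y t)).sub
      ((hu.smooth3_Dx.smooth3_Dt.hasDerivAt_Dy x y t).mul (hs.hasDerivAt_Dy x y t))).const_mul _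
  rw [hs.Dy_Dt_comm, hu.Dy_Dt_comm, hu.smooth3_Dx.Dy_Dt_comm, ← hu.Dx_Dy_comm,
    ← hs.Dx_Dy_comm, eq_inv_mul_iff_mul_eq₀ hl1] at hyt
  rw [eq_inv_mul_iff_mul_eq₀ hlam0] at hty
  unfold linMVWE
  linear_combination hyt - hty


/-- Solutions `s` of the covering `s_t = (λ+1)⁻¹ (u_t s_x - u_tx s)`,
`s_y = λ⁻¹ (u_y s_x - u_xy s)` are shadows of symmetries of the modified Veronese web
equation; in particular `s = 1/q_x` for a solution `q` of the Lax pair with nonvanishing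
`q_x` satisfies this system and hence is such a shadow. -/
theorem mvwe_s_covering_shadow
    (u : ℝ → ℝ → ℝ → ℝ) (hu : Smooth3 u)
    (husol : ∀ x y t : ℝ, Dt (Dy u) x y t = Dt u x y t * Dx (Dy u) x y t - Dy u x y t * Dt (Dx u) x y t)
    (lam : ℝ) (hlam0 : lam ≠ 0) (hlam1 : lam ≠ -1)
    (s : ℝ → ℝ → ℝ → ℝ) (hs : Smooth3 s)
    (hst : ∀ x y t : ℝ,
      Dt s x y t = (lam + 1)⁻¹ * (Dt u x y t * Dx s x y t - Dt (Dx u) x y t * s x y t))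
    (hsy : ∀ x y t : ℝ,
      Dy s x y t = lam⁻¹ * (Dy u x y t * Dx s x y t - Dx (Dy u) x y t * s x y t)) :
    (∀ x y t : ℝ, linMVWE u s x y t = 0) ∧
    (∀ q : ℝ → ℝ → ℝ → ℝ, Smooth3 q →
      (∀ x y t : ℝ, Dt q x y t = (lam + 1)⁻¹ * Dt u x y t * Dx q x y t) →
      (∀ x y t : ℝ, Dy q x y t = lam⁻¹ * Dy u x y t * Dx q x y t) →
      (∀ x y t : ℝ, Dx q x y t ≠ 0) →
      ((∀ x y t : ℝ,
          Dt (fun a b c => 1 / Dx q a b c) x y t = (lam + 1)⁻¹ *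
            (Dt u x y t * Dx (fun a b c => 1 / Dx q a b c) x y t
              - Dt (Dx u) x y t * (1 / Dx q x y t))) ∧
       (∀ x y t : ℝ,
          Dy (fun a b c => 1 / Dx q a b c) x y t = lam⁻¹ *
            (Dy u x y t * Dx (fun a b c => 1 / Dx q a b c) x y t
              - Dx (Dy u) x y t * (1 / Dx q x y t))) ∧
       (∀ x y t : ℝ, linMVWE u (fun a b c => 1 / Dx q a b c) x y t = 0))) := by
  refine ⟨linMVWE_eq_zero_of_covering hu hlam0 hlam1 hs hst hsy, fun q hq hqt hqy hq0 => ?_⟩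
  have hx : ∀ x y t, Dx (fun a b c => 1 / Dx q a b c) x y t =
      -Dx (Dx q) x y t / Dx q x y t ^ 2 := fun x y t => by
    simpa [Dx] using ((hq.smooth3_Dx.hasDerivAt_Dx x y t).fun_inv (hq0 x y t)).deriv
  have ht : ∀ x y t, Dt (fun a b c => 1 / Dx q a b c) x y t = (lam + 1)⁻¹ *
      (Dt u x y t * Dx (fun a b c => 1 / Dx q a b c) x y t
        - Dt (Dx u) x y t * (1 / Dx q x y t)) := fun x y t => by
    have hinv : Dt (fun a b c => 1 / Dx q a b c) x y t = -Dt (Dx q) x y t / Dx q x y t ^ 2 := by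
      simpa [Dt] using ((hq.smooth3_Dx.hasDerivAt_Dt x y t).fun_inv (hq0 x y t)).deriv
    have hqtx : Dx (Dt q) x y t = (lam + 1)⁻¹ * Dx (Dt u) x y t * Dx q x y t
        + (lam + 1)⁻¹ * Dt u x y t * Dx (Dx q) x y t := by
      refine HasDerivAt.deriv ?_
      simp only [hqt]
      exact ((hu.smooth3_Dt.hasDerivAt_Dx x y t).const_mul _).mul
        (hq.smooth3_Dx.hasDerivAt_Dx x y t)
    rw [hinv, hx, ← hq.Dx_Dt_comm, hqtx, hu.Dx_Dt_comm]
    have := hq0 x y t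
    generalize (lam + 1)⁻¹ = c
    field_simp
    ring
  have hy : ∀ x y t, Dy (fun a b c => 1 / Dx q a b c) x y t = lam⁻¹ *
      (Dy u x y t * Dx (fun a b c => 1 / Dx q a b c) x y t
        - Dx (Dy u) x y t * (1 / Dx q x y t)) := fun x y t => by
    have hinv : Dy (fun a b c => 1 / Dx q a b c) x y t = -Dy (Dx q) x y t / Dx q x y t ^ 2 := by
      simpa [Dy] using ((hq.smooth3_Dx.hasDerivAt_Dy x y t).fun_inv (hq0 x y t)).deriv
    have hqyx : Dx (Dy q) x y t = lam⁻¹ * Dx (Dy u) x y t * Dx q x y t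
        + lam⁻¹ * Dy u x y t * Dx (Dx q) x y t := by
      refine HasDerivAt.deriv ?_
      simp only [hqy]
      exact ((hu.smooth3_Dy.hasDerivAt_Dx x y t).const_mul _).mul
        (hq.smooth3_Dx.hasDerivAt_Dx x y t)
    rw [hinv, hx, ← hq.Dx_Dy_comm, hqyx]
    have := hq0 x y t
    generalize lam⁻¹ = c
    field_simp
    ring
  exact ⟨ht, hy, linMVWE_eq_zero_of_covering hu hlam0 hlam1 (hq.smooth3_Dx.one_div hq0) ht hy⟩
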